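/- Let F : ℙ^n → ℙ be (𝒰 ∪ {ε})-definable. Then there exist a tuple s⃗ ∈ ℙ^n and a number m ∈ ℕ such that F is uniformly continuous on the set {t⃗ ∈ ℙ^n : s⃗_{|m} = t⃗_{|m}}. -/

import Mathlib

noncomputable section
open Classical

/-- `s ⊕ t`: lifted addition on sets of naturals. -/
def setPlus (s t : Set ℕ) : Set ℕ := {u | ∃ m ∈ s, ∃ n ∈ t, u = m + n}

/-- `s ⊗ t`: lifted multiplication on sets of naturals. -/
def setTimes (s t : Set ℕ) : Set ℕ := {u | ∃ m ∈ s, ∃ n ∈ t, u = m * n}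

/-- Sets of naturals definable by (variable-free) arithmetic circuits:
the smallest collection containing `∅`, `ℕ`, all singletons, closed under
union, intersection, complement, `⊕` and `⊗`. -/
inductive ArithDefinable : Set ℕ → Prop
  | empty : ArithDefinable ∅
  | univ : ArithDefinable Set.univ
  | single (k : ℕ) : ArithDefinable {k}
  | union : ∀ {s t : Set ℕ}, ArithDefinable s → ArithDefinable t → ArithDefinable (s ∪ t)
  | inter : ∀ {s t : Set ℕ}, ArithDefinable s → ArithDefinable t → ArithDefinable (s ∩ t)
  | compl : ∀ {s : Set ℕ}, ArithDefinable s → ArithDefinable sᶜ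
  | plus : ∀ {s t : Set ℕ}, ArithDefinable s → ArithDefinable t → ArithDefinable (setPlus s t)
  | times : ∀ {s t : Set ℕ}, ArithDefinable s → ArithDefinable t → ArithDefinable (setTimes s t)

/-- A set-function of arity `k`. -/
abbrev SetFun (k : ℕ) := (Fin k → Set ℕ) → Set ℕ

/-- The `𝒪`-definable functions `ℙ^n → ℙ`, for a collection `O` of set-functions
(given per arity): smallest class containing projections and the constants
`∅`, `ℕ`, `{k}`, closed under pointwise union, intersection, complement, and
composition with functions in `O`. -/
inductive ODef (O : ∀ k, Set (SetFun k)) (n : ℕ) : SetFun n → Prop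
  | proj (i : Fin n) : ODef O n (fun s => s i)
  | empty : ODef O n (fun _ => ∅)
  | univ : ODef O n (fun _ => Set.univ)
  | single (k : ℕ) : ODef O n (fun _ => {k})
  | union : ∀ {F G : SetFun n}, ODef O n F → ODef O n G → ODef O n (fun s => F s ∪ G s)
  | inter : ∀ {F G : SetFun n}, ODef O n F → ODef O n G → ODef O n (fun s => F s ∩ G s)
  | compl : ∀ {F : SetFun n}, ODef O n F → ODef O n (fun s => (F s)ᶜ)
  | comp : ∀ {k : ℕ} {g : SetFun k} {F : Fin k → SetFun n},
      g ∈ O k → (∀ i, ODef O n (F i)) → ODef O n (fun s => g (fun i => F i s))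

/-- `s_{|m} = s ∩ {0,…,m}`. -/
def restrict (s : Set ℕ) (m : ℕ) : Set ℕ := s ∩ {k | k ≤ m}

/-- `F` is `h`-continuous on `D`. -/
def HCont (h : ℕ → ℕ) {n : ℕ} (F : SetFun n) (D : Set (Fin n → Set ℕ)) : Prop :=
  ∀ m : ℕ, ∀ s ∈ D, ∀ t ∈ D,
    (∀ i, restrict (s i) (h m) = restrict (t i) (h m)) →
    restrict (F s) m = restrict (F t) m

/-- `F` is uniformly continuous on `D`. -/
def UnifCont {n : ℕ} (F : SetFun n) (D : Set (Fin n → Set ℕ)) : Prop :=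
  ∃ h : ℕ → ℕ, HCont h F D

/-- `𝒰`: set-functions (of arity `k`) uniformly continuous on the whole space. -/
def Ucal (k : ℕ) : Set (SetFun k) := {g | UnifCont g Set.univ}

/-- `𝒫`: predicates, i.e. set-functions with values among `∅` and `{0}`. -/
def Pcal (k : ℕ) : Set (SetFun k) := {g | ∀ s, g s = ∅ ∨ g s = {0}}

/-- `𝒰 ∪ 𝒫`. -/
def UPcal (k : ℕ) : Set (SetFun k) := Ucal k ∪ Pcal k

/-- `Max(x)`. -/
def MaxFun (x : Set ℕ) : Set ℕ :=
  if x = ∅ then ∅ else if x.Infinite then Set.univ else {sSup x}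

/-- `Card(x)`. -/
def CardFun (x : Set ℕ) : Set ℕ := if x.Finite then {x.ncard} else Set.univ

/-- `↓(x)`. -/
def DownFun (x : Set ℕ) : Set ℕ := {m | ∃ n ∈ x, m ≤ n}

/-- `Sum(x)`. -/
def SumFun (x : Set ℕ) : Set ℕ := if x.Finite then {∑ᶠ n ∈ x, n} else Set.univ

/-- `Prod(x)`. -/
def ProdFun (x : Set ℕ) : Set ℕ := if x.Finite then {∏ᶠ n ∈ x, n} else Set.univ

/-- `Shove(x) = {n - min x : n ∈ x}` (empty for `x = ∅`). -/
def ShoveFun (x : Set ℕ) : Set ℕ := (fun n => n - sInf x) '' x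

/-- `ε(x)`: the test for emptiness. -/
def epsFun (x : Set ℕ) : Set ℕ := if x = ∅ then {0} else ∅

/-- `Fin(x)`: the test for finiteness. -/
def FinFun (x : Set ℕ) : Set ℕ := if x.Finite then {0} else ∅

/-- `⊕` as a set-function of arity 2. -/
def plusFun : SetFun 2 := fun s => setPlus (s 0) (s 1)

/-- `⊗` as a set-function of arity 2. -/
def timesFun : SetFun 2 := fun s => setTimes (s 0) (s 1)

/-- `↓` as a set-function of arity 1. -/
def downFun1 : SetFun 1 := fun s => DownFun (s 0)

/-- `ε` as a set-function of arity 1. -/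
def epsFun1 : SetFun 1 := fun s => epsFun (s 0)

/-- The collection `{⊕, ⊗}`. -/
def arithO : ∀ k, Set (SetFun k)
  | 2 => {plusFun, timesFun}
  | _ => ∅

/-- The collection `{⊕}`. -/
def addO : ∀ k, Set (SetFun k)
  | 2 => {plusFun}
  | _ => ∅

/-- The collection `{⊕, ↓} ∪ 𝒫`. -/
def addDownO : ∀ k, Set (SetFun k)
  | 1 => insert downFun1 (Pcal 1)
  | 2 => insert plusFun (Pcal 2)
  | k => Pcal k

/-- The collection `{⊕, ⊗, ↓} ∪ 𝒫`. -/
def arithDownO : ∀ k, Set (SetFun k)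
  | 1 => insert downFun1 (Pcal 1)
  | 2 => {plusFun, timesFun} ∪ Pcal 2
  | k => Pcal k

/-- The collection `𝒰 ∪ {ε}`. -/
def UEps : ∀ k, Set (SetFun k)
  | 1 => insert epsFun1 (Ucal 1)
  | k => Ucal k

/-- The collection `{⊕, ⊗} ∪ 𝒫`. -/
def arithPO (k : ℕ) : Set (SetFun k) := arithO k ∪ Pcal k

/-- A numerical function `ℕ → ℕ` is `O`-definable if some `O`-definable
set-function maps `{m}` to `{f m}` for every `m`. -/
def NumDef1 (O : ∀ k, Set (SetFun k)) (f : ℕ → ℕ) : Prop :=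
  ∃ F : SetFun 1, ODef O 1 F ∧ ∀ m : ℕ, F (fun _ => {m}) = {f m}

/-- A numerical function `ℕ^k → ℕ` is `O`-definable if some `O`-definable
set-function maps tuples of singletons to the corresponding singleton value. -/
def NumDef (O : ∀ k, Set (SetFun k)) (k : ℕ) (f : (Fin k → ℕ) → ℕ) : Prop :=
  ∃ F : SetFun k, ODef O k F ∧ ∀ m : Fin k → ℕ, F (fun i => ({m i} : Set ℕ)) = {f m}

/-- `f` is regressive: `{f n : f n < n}` is infinite. -/
def Regressive (f : ℕ → ℕ) : Prop := {y | ∃ n, f n = y ∧ y < n}.Infinite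

/-- `f` is semi-regressive: for every `ℓ` there is `n` with `n + ℓ ≤ f n ≤ 2n - 2`. -/
def SemiRegressive (f : ℕ → ℕ) : Prop :=
  ∀ ℓ : ℕ, ∃ n : ℕ, n + ℓ ≤ f n ∧ (f n : ℤ) ≤ 2 * (n : ℤ) - 2

/-- The tuples agreeing with `s` up to `m`. -/
def cylinder {n : ℕ} (s : Fin n → Set ℕ) (m : ℕ) : Set (Fin n → Set ℕ) :=
  {t | ∀ i, restrict (s i) m = restrict (t i) m}

theorem restrict_eq_iff {s t : Set ℕ} {m : ℕ} :
    restrict s m = restrict t m ↔ ∀ k ≤ m, (k ∈ s ↔ k ∈ t) := by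
  simp only [restrict, Set.ext_iff, Set.mem_inter_iff, Set.mem_ofPred_eq]
  exact forall_congr' fun k => by tauto

theorem restrict_eq_of_le {s t : Set ℕ} {m k : ℕ} (hk : k ≤ m)
    (h : restrict s m = restrict t m) : restrict s k = restrict t k := by
  rw [restrict_eq_iff] at h ⊢
  exact fun j hj => h j (hj.trans hk)

theorem cylinder_subset_cylinder {n : ℕ} {s t : Fin n → Set ℕ} {m k : ℕ} (hk : k ≤ m)
    (ht : t ∈ cylinder s k) : cylinder t m ⊆ cylinder s k :=
  fun _ hu i => (ht i).trans (restrict_eq_of_le hk (hu i))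

theorem UnifCont.mono {n : ℕ} {F : SetFun n} {D E : Set (Fin n → Set ℕ)}
    (hF : UnifCont F D) (hE : E ⊆ D) : UnifCont F E := by
  obtain ⟨h, hh⟩ := hF
  exact ⟨h, fun m s hs t ht => hh m s (hE hs) t (hE ht)⟩

theorem UnifCont.congr_const {n : ℕ} {F : SetFun n} {D : Set (Fin n → Set ℕ)} (c : Set ℕ)
    (hF : ∀ s ∈ D, F s = c) : UnifCont F D :=
  ⟨id, fun m s hs t ht _ => by rw [hF s hs, hF t ht]⟩

theorem UnifCont.comp {n k : ℕ} {g : SetFun k} {F : Fin k → SetFun n}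
    {D : Set (Fin n → Set ℕ)} (hg : UnifCont g Set.univ) (hF : ∀ i, UnifCont (F i) D) :
    UnifCont (fun s => g (fun i => F i s)) D := by
  obtain ⟨hg, hhg⟩ := hg
  choose h hh using hF
  refine ⟨fun m => Finset.univ.sup fun i => h i (hg m), fun m s hs t ht hst => ?_⟩
  refine hhg m _ trivial _ trivial fun i => hh i (hg m) s hs t ht fun j => ?_
  exact restrict_eq_of_le
    (Finset.le_sup (f := fun i => h i (hg m)) (Finset.mem_univ i)) (hst j)

/-- Every cylinder contains a cylinder on which `F` is uniformly continuous. -/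
def DenselyUnifCont {n : ℕ} (F : SetFun n) : Prop :=
  ∀ s m, ∃ t k, cylinder t k ⊆ cylinder s m ∧ UnifCont F (cylinder t k)

theorem UnifCont.denselyUnifCont {n : ℕ} {F : SetFun n} (hF : UnifCont F Set.univ) :
    DenselyUnifCont F :=
  fun s m => ⟨s, m, subset_rfl, hF.mono (Set.subset_univ _)⟩

theorem exists_common_cylinder {n : ℕ} {ι : Type*} (A : Finset ι) {F : ι → SetFun n}
    (hF : ∀ i, DenselyUnifCont (F i)) (s : Fin n → Set ℕ) (m : ℕ) :
    ∃ t k, cylinder t k ⊆ cylinder s m ∧ ∀ i ∈ A, UnifCont (F i) (cylinder t k) := by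
  induction A using Finset.induction_on with
  | empty => exact ⟨s, m, subset_rfl, by simp⟩
  | insert a A _ ih =>
    obtain ⟨t, k, hsub, hA⟩ := ih
    obtain ⟨u, l, hsub', ha⟩ := hF a t k
    refine ⟨u, l, hsub'.trans hsub, fun i hi => ?_⟩
    rcases Finset.mem_insert.1 hi with rfl | hi
    · exact ha
    · exact (hA i hi).mono hsub'

theorem DenselyUnifCont.comp {n k : ℕ} {g : SetFun k} {F : Fin k → SetFun n}
    (hg : UnifCont g Set.univ) (hF : ∀ i, DenselyUnifCont (F i)) :
    DenselyUnifCont (fun s => g (fun i => F i s)) := by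
  intro s m
  obtain ⟨t, k, hsub, hA⟩ := exists_common_cylinder Finset.univ hF s m
  exact ⟨t, k, hsub, hg.comp fun i => hA i (Finset.mem_univ i)⟩

theorem DenselyUnifCont.eps {n : ℕ} {F : SetFun n} (hF : DenselyUnifCont F) :
    DenselyUnifCont (fun s => epsFun (F s)) := by
  intro s m
  obtain ⟨t, k, hsub, h, hh⟩ := hF s m
  by_cases hempty : ∀ u ∈ cylinder t k, F u = ∅
  · exact ⟨t, k, hsub, .congr_const {0} fun u hu => by simp [epsFun, hempty u hu]⟩
  push Not at hempty
  obtain ⟨u, hu, j, hj⟩ := hempty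
  have hsub' := cylinder_subset_cylinder (le_max_left k (h j)) hu
  refine ⟨u, max k (h j), hsub'.trans hsub, .congr_const ∅ fun v hv => ?_⟩
  have hjv : j ∈ F v := (restrict_eq_iff.1 (hh j u hu v (hsub' hv) fun i =>
    restrict_eq_of_le (le_max_right _ _) (hv i)) j le_rfl).1 hj
  exact if_neg (Set.nonempty_iff_ne_empty.1 ⟨j, hjv⟩)

theorem unifCont_union : UnifCont (fun s : Fin 2 → Set ℕ => s 0 ∪ s 1) Set.univ :=
  ⟨id, fun m s _ t _ h => by
    simp only [restrict_eq_iff, id] at h ⊢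
    exact fun k hk => or_congr (h 0 k hk) (h 1 k hk)⟩

theorem unifCont_inter : UnifCont (fun s : Fin 2 → Set ℕ => s 0 ∩ s 1) Set.univ :=
  ⟨id, fun m s _ t _ h => by
    simp only [restrict_eq_iff, id] at h ⊢
    exact fun k hk => and_congr (h 0 k hk) (h 1 k hk)⟩

theorem unifCont_compl : UnifCont (fun s : Fin 1 → Set ℕ => (s 0)ᶜ) Set.univ :=
  ⟨id, fun m s _ t _ h => by
    simp only [restrict_eq_iff, id] at h ⊢
    exact fun k hk => not_congr (h 0 k hk)⟩

theorem UEps_comp_denselyUnifCont {n k : ℕ} {g : SetFun k} {F : Fin k → SetFun n}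
    (hg : g ∈ UEps k) (hF : ∀ i, DenselyUnifCont (F i)) :
    DenselyUnifCont (fun s => g (fun i => F i s)) := by
  obtain _ | _ | k := k
  · exact .comp hg hF
  · obtain rfl | hg := hg
    · exact (hF 0).eps
    · exact .comp hg hF
  · exact .comp hg hF

theorem ODef.denselyUnifCont {n : ℕ} {F : SetFun n} (hF : ODef UEps n F) :
    DenselyUnifCont F := by
  induction hF with
  | proj i => exact UnifCont.denselyUnifCont ⟨id, fun m s _ t _ h => h i⟩
  | empty => exact (UnifCont.congr_const ∅ fun _ _ => rfl).denselyUnifCont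
  | univ => exact (UnifCont.congr_const Set.univ fun _ _ => rfl).denselyUnifCont
  | single k => exact (UnifCont.congr_const {k} fun _ _ => rfl).denselyUnifCont
  | @union F G _ _ hF hG =>
    exact DenselyUnifCont.comp (F := ![F, G]) unifCont_union (Fin.forall_fin_two.2 ⟨hF, hG⟩)
  | @inter F G _ _ hF hG =>
    exact DenselyUnifCont.comp (F := ![F, G]) unifCont_inter (Fin.forall_fin_two.2 ⟨hF, hG⟩)
  | @compl F _ hF => exact DenselyUnifCont.comp (F := ![F]) unifCont_compl (by simpa using hF)
  | comp hg _ hF => exact UEps_comp_denselyUnifCont hg hF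

theorem UEps_definable_unifCont_on_cylinder (n : ℕ) (F : SetFun n)
    (hF : ODef UEps n F) :
    ∃ (s : Fin n → Set ℕ) (m : ℕ),
      UnifCont F {t : Fin n → Set ℕ | ∀ i, restrict (s i) m = restrict (t i) m} := by
  obtain ⟨s, m, -, h⟩ := hF.denselyUnifCont (fun _ => ∅) 0
  exact ⟨s, m, h⟩

end
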